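/- arXiv:math/0411125 — 3 statements merged into one kernel-verified Lean document; each statement's English description precedes it below -/
import Mathlib

section
/- Let A be a commutative ring with dim A/J(A) = d, where J(A) is the Jacobson radical. Then any finitely generated projective A-module P of rank > d has a unimodular element. (Serre's splitting theorem.) -/
section LinearAlgebra

open Module Submodule

variable {K V : Type*} [Field K] [AddCommGroup V] [Module K V]

theorem span_insert_add_smul_le {n : Type*} (u : V) (w : n → V) (a : n → K) :
    span K (insert u (Set.range fun i => w i + a i • u)) ≤ span K (insert u (Set.range w)) := by
  have hu : u ∈ span K (insert u (Set.range w)) := subset_span (Set.mem_insert _ _)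
  rw [span_le, Set.insert_subset_iff]
  refine ⟨hu, ?_⟩
  rintro _ ⟨i, rfl⟩
  exact add_mem (subset_span (Set.mem_insert_of_mem _ ⟨i, rfl⟩)) (smul_mem _ _ hu)

theorem span_insert_add_smul {n : Type*} (u : V) (w : n → V) (a : n → K) :
    span K (insert u (Set.range fun i => w i + a i • u)) = span K (insert u (Set.range w)) := by
  refine le_antisymm (span_insert_add_smul_le u w a) ?_
  simpa using span_insert_add_smul_le u (fun i => w i + a i • u) (-a)

theorem finrank_span_insert_le {n : Type*} [Finite n] (u : V) (w : n → V) (a : n → K) :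
    finrank K (span K (insert u (Set.range w))) ≤
      finrank K (span K (Set.range fun i => w i + a i • u)) + 1 := by
  have : FiniteDimensional K (span K (Set.range fun i => w i + a i • u)) :=
    FiniteDimensional.span_of_finite K (Set.finite_range _)
  rw [← span_insert_add_smul u w a, span_insert, add_comm]
  refine (finrank_add_le_finrank_add_finrank _ _).trans (Nat.add_le_add_right ?_ _)
  simpa using finrank_span_le_card (R := K) ({u} : Set V)

theorem exists_span_insert_le {n : ℕ} (u : V) (w : Fin n → V)
    (h : finrank K (span K (insert u (Set.range w))) ≤ n) :
    ∃ c : Fin n → ℤ, ∀ b : K, b ≠ 0 →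
      span K (insert u (Set.range w)) ≤ span K (Set.range fun i => w i + (b * c i) • u) := by
  by_cases hu : u ∈ span K (Set.range w)
  · refine ⟨0, fun b _ => ?_⟩
    simp [span_insert_eq_span hu]
  have hdep : ¬ LinearIndependent K w := by
    intro hw
    have := finrank_span_eq_card (linearIndependent_finCons.2 ⟨hw, hu⟩)
    rw [Fin.range_cons, Fintype.card_fin] at this
    omega
  rw [linearIndependent_iff_notMem_span] at hdep
  push Not at hdep
  obtain ⟨i, hi⟩ := hdep
  refine ⟨Pi.single i 1, fun b hb => ?_⟩
  set W := span K (Set.range fun j => w j + (b * ((Pi.single i 1 : Fin n → ℤ) j : K)) • u) with hW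
  have hj : ∀ j, j ≠ i → w j ∈ W := by
    intro j hji
    have : w j + (b * ((Pi.single i 1 : Fin n → ℤ) j : K)) • u ∈ W := subset_span ⟨j, rfl⟩
    simpa [Pi.single_eq_of_ne hji] using this
  have hwi : w i ∈ W := by
    refine span_le.2 ?_ hi
    rintro _ ⟨j, hj', rfl⟩
    exact hj j (by simpa using hj')
  have hbu : b • u ∈ W := by
    have : w i + (b * ((Pi.single i 1 : Fin n → ℤ) i : K)) • u ∈ W := subset_span ⟨i, rfl⟩
    simpa using sub_mem this hwi
  rw [span_le, Set.insert_subset_iff]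
  refine ⟨(smul_mem_iff _ hb).1 hbu, ?_⟩
  rintro _ ⟨j, rfl⟩
  by_cases hji : j = i
  · exact hji ▸ hwi
  · exact hj j hji

/-- A matrix over a field has an invertible square submatrix of size its row rank. -/
theorem exists_det_submatrix_ne_zero {m n : Type*} [Fintype m] [Fintype n] (M : Matrix m n K)
    (r : ℕ) (h : r ≤ finrank K (span K (Set.range M.row))) :
    ∃ (s : Fin r → m) (t : Fin r → n), (M.submatrix s t).det ≠ 0 := by
  obtain ⟨ι, s, hs, hspan, hli⟩ := exists_linearIndependent' K M.row
  have : Finite ι := Finite.of_injective s hs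
  have : Fintype ι := Fintype.ofFinite ι
  rw [← hspan, finrank_span_eq_card hli] at h
  obtain ⟨e⟩ : Nonempty (Fin r ↪ ι) := Function.Embedding.nonempty_of_card_le (by simpa using h)
  have hrow : LinearIndependent K (M.submatrix (s ∘ e) id).row := hli.comp _ e.injective
  obtain ⟨κ, t, ht, htspan, htli⟩ := exists_linearIndependent' K (M.submatrix (s ∘ e) id).col
  have : Finite κ := Finite.of_injective t ht
  have : Fintype κ := Fintype.ofFinite κ
  have hcard := finrank_span_eq_card htli
  rw [htspan, ← Matrix.rank_eq_finrank_span_cols, hrow.rank_matrix, Fintype.card_fin] at hcard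
  let e' : Fin r ≃ κ := Fintype.equivOfCardEq (by simpa using hcard)
  refine ⟨s ∘ e, t ∘ e', ?_⟩
  have hcol : LinearIndependent K (M.submatrix (s ∘ e) (t ∘ e')).col := htli.comp e' e'.injective
  rw [← isUnit_iff_ne_zero, ← Matrix.isUnit_iff_isUnit_det]
  exact Matrix.linearIndependent_cols_iff_isUnit.1 hcol

end LinearAlgebra

/-- If `G p` is insensitive to changes modulo `p` and any `a` can be moved into `G p` along some
direction, then the conditions `G p` at finitely many primes can be met simultaneously. -/
theorem PrimeSpectrum.exists_forall_of_finset {A : Type*} [CommRing A] {X : Type*}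
    (f : X → PrimeSpectrum A) (hf : Function.Injective f) {M : Type*} [AddCommGroup M] [Module A M] (G : X → M → Prop)
    (hG : ∀ p, ∀ a b : M, G p a → ∀ c ∈ (f p).asIdeal, G p (a + c • b))
    (S : Finset X)
    (hS : ∀ p ∈ S, ∀ a, ∃ c, ∀ b ∉ (f p).asIdeal, G p (a + b • c)) :
    ∃ a, ∀ p ∈ S, G p a := by
  classical
  let : PartialOrder X := PartialOrder.lift f hf
  induction h : S.card generalizing S with
  | zero => exact ⟨0, by simp_all⟩
  | succ k ih =>
    obtain ⟨p, hp⟩ := S.exists_minimal (Finset.card_pos.1 (by omega))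
    obtain ⟨a, ha⟩ := ih (S.erase p) (fun q hq => hS q (Finset.mem_of_mem_erase hq))
      (by rw [Finset.card_erase_of_mem hp.1]; omega)
    obtain ⟨c, hc⟩ := hS p hp.1 a
    have : ¬ (S.erase p).inf (fun q => (f q).asIdeal) ≤ (f p).asIdeal := by
      rw [(f p).isPrime.inf_le']
      rintro ⟨q, hq, hqp⟩
      exact Finset.ne_of_mem_erase hq (le_antisymm hqp (hp.2 (Finset.mem_of_mem_erase hq) hqp))
    obtain ⟨b, hb, hbp⟩ := Set.not_subset.1 this
    refine ⟨a + b • c, fun q hq => ?_⟩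
    by_cases hqp : q = p
    · exact hqp ▸ hc b hbp
    · have hq' := Finset.mem_erase.2 ⟨hqp, hq⟩
      exact hG q a c (ha q hq') b ((Submodule.mem_finsetInf.1 hb) q hq')

section fiber

open Module Submodule PrimeSpectrum

variable {A : Type*} [CommRing A] {m : Type*}

/-- The dimension of the span of the vectors `v i` in the fibre at `p`. -/
noncomputable def fiberRank {n : Type*} (v : n → m → A) (p : PrimeSpectrum A) : ℕ :=
  finrank p.asIdeal.ResidueField (span p.asIdeal.ResidueField
    (Set.range fun i j => algebraMap A p.asIdeal.ResidueField (v i j)))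

theorem fiberRank_eq {n : Type*} {v : n → m → A} {p : PrimeSpectrum A}
    {x : n → m → p.asIdeal.ResidueField} (h : ∀ i j, algebraMap A _ (v i j) = x i j) :
    fiberRank v p = finrank p.asIdeal.ResidueField (span p.asIdeal.ResidueField (Set.range x)) := by
  obtain rfl : (fun i j => algebraMap A _ (v i j)) = x := funext fun i => funext (h i)
  rfl

theorem fiberRank_cons {n : ℕ} (u : m → A) (w : Fin n → m → A) (p : PrimeSpectrum A) :
    fiberRank (Fin.cons u w : Fin (n + 1) → m → A) p =
      finrank p.asIdeal.ResidueField (span p.asIdeal.ResidueField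
        (insert (fun j => algebraMap A p.asIdeal.ResidueField (u j))
          (Set.range fun i j => algebraMap A p.asIdeal.ResidueField (w i j)))) := by
  rw [← Fin.range_cons]
  exact fiberRank_eq fun i j => by refine Fin.cases ?_ (fun i => ?_) i <;> rfl

theorem fiberRank_add_smul {n : Type*} (u : m → A) (w : n → m → A) (a : n → A)
    (p : PrimeSpectrum A) :
    fiberRank (fun i => w i + a i • u) p =
      finrank p.asIdeal.ResidueField (span p.asIdeal.ResidueField
        (Set.range fun i => (fun j => algebraMap A p.asIdeal.ResidueField (w i j)) +
          algebraMap A p.asIdeal.ResidueField (a i) •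
            fun j => algebraMap A p.asIdeal.ResidueField (u j))) :=
  fiberRank_eq fun i j => by simp [Algebra.smul_def]

theorem fiberRank_cons_add_smul {n : ℕ} (u : m → A) (w : Fin n → m → A) (a : Fin n → A)
    (p : PrimeSpectrum A) :
    fiberRank (Fin.cons u (fun i => w i + a i • u) : Fin (n + 1) → m → A) p =
      fiberRank (Fin.cons u w : Fin (n + 1) → m → A) p := by
  rw [fiberRank_cons, fiberRank_cons, ← span_insert_add_smul _
    (fun i j => algebraMap A p.asIdeal.ResidueField (w i j))
    fun i => algebraMap A p.asIdeal.ResidueField (a i)]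
  have (i : Fin n) : (fun j => algebraMap A p.asIdeal.ResidueField ((w i + a i • u) j)) =
      (fun j => algebraMap A p.asIdeal.ResidueField (w i j)) +
        algebraMap A p.asIdeal.ResidueField (a i) •
          fun j => algebraMap A p.asIdeal.ResidueField (u j) := by
    ext j
    simp [Algebra.smul_def]
  exact congrArg (fun x : Fin n → m → p.asIdeal.ResidueField => finrank p.asIdeal.ResidueField
    (span p.asIdeal.ResidueField (insert _ (Set.range x)))) (funext this)

theorem fiberRank_congr {n : Type*} {v w : n → m → A} {p : PrimeSpectrum A}
    (h : ∀ i j, v i j - w i j ∈ p.asIdeal) : fiberRank v p = fiberRank w p := by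
  have : (fun i j => algebraMap A p.asIdeal.ResidueField (v i j)) =
      fun i j => algebraMap A p.asIdeal.ResidueField (w i j) := by
    ext i j
    rw [← sub_eq_zero, ← map_sub, Ideal.algebraMap_residueField_eq_zero]
    exact h i j
  rw [fiberRank, this, fiberRank]

/-- A lower bound on the fibre rank is detected by the nonvanishing of a minor. -/
theorem le_fiberRank_iff {n : Type*} [Fintype m] [Fintype n] (v : n → m → A) (p : PrimeSpectrum A)
    (r : ℕ) : r ≤ fiberRank v p ↔ ∃ (s : Fin r → n) (t : Fin r → m),
      ((Matrix.of v).submatrix s t).det ∉ p.asIdeal := by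
  have key : ∀ (s : Fin r → n) (t : Fin r → m), ((Matrix.of v).submatrix s t).det ∉ p.asIdeal ↔
      ((Matrix.of fun i j => algebraMap A p.asIdeal.ResidueField (v i j)).submatrix s t).det ≠ 0 := by
    intro s t
    rw [← Ideal.algebraMap_residueField_eq_zero, RingHom.map_det]
    rfl
  simp_rw [key]
  refine ⟨fun h => exists_det_submatrix_ne_zero _ r h, ?_⟩
  rintro ⟨s, t, h⟩
  have := Matrix.rank_of_det_ne_zero h
  rw [Fintype.card_fin] at this
  have h2 := Matrix.rank_submatrix_le
    (Matrix.of fun i j => algebraMap A p.asIdeal.ResidueField (v i j)) s t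
  rw [this, Matrix.rank_eq_finrank_span_row] at h2
  exact h2

theorem isClosed_setOf_fiberRank_le {n : Type*} [Fintype m] [Fintype n] (v : n → m → A) (r : ℕ) :
    IsClosed {p | fiberRank v p ≤ r} := by
  have : {p | fiberRank v p ≤ r} =
      zeroLocus {a | ∃ (s : Fin (r + 1) → n) (t : Fin (r + 1) → m),
        ((Matrix.of v).submatrix s t).det = a} := by
    ext p
    rw [Set.mem_ofPred_eq, ← not_lt, Nat.lt_iff_add_one_le, le_fiberRank_iff]
    push Not
    rw [mem_zeroLocus]
    constructor
    · rintro h _ ⟨s, t, rfl⟩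
      exact h s t
    · exact fun h s t => h ⟨s, t, rfl⟩
  rw [this]
  exact isClosed_zeroLocus _

theorem PrimeSpectrum.finite_setOf_minimal [IsNoetherianRing A] {Z : Set (PrimeSpectrum A)}
    (hZ : IsClosed Z) : {p | Minimal (· ∈ Z) p}.Finite := by
  obtain ⟨I, rfl⟩ := (isClosed_iff_zeroLocus_ideal Z).1 hZ
  refine ((I.finite_minimalPrimes_of_isNoetherianRing A).preimage
    (f := PrimeSpectrum.asIdeal) fun x _ y _ h => PrimeSpectrum.ext h).subset ?_
  intro p hp
  exact ⟨⟨p.isPrime, hp.1⟩, fun q hq hqp => hp.2 (y := ⟨q, hq.1⟩) hq.2 hqp⟩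

theorem fiberRank_cons_le {n : ℕ} (u : m → A) (w : Fin n → m → A) (a : Fin n → A)
    (p : PrimeSpectrum A) :
    fiberRank (Fin.cons u w : Fin (n + 1) → m → A) p ≤ fiberRank (fun i => w i + a i • u) p + 1 := by
  rw [fiberRank_cons, fiberRank_add_smul]
  exact finrank_span_insert_le _ _ _

theorem exists_fiberRank_cons_le {n : ℕ} (u : m → A) (w : Fin n → m → A) (p : PrimeSpectrum A)
    (h : fiberRank (Fin.cons u w : Fin (n + 1) → m → A) p ≤ n) :
    ∃ c : Fin n → A, ∀ b ∉ p.asIdeal, fiberRank (Fin.cons u w : Fin (n + 1) → m → A) p ≤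
      fiberRank (fun i => w i + (b • c) i • u) p := by
  rw [fiberRank_cons] at h ⊢
  obtain ⟨c, hc⟩ := exists_span_insert_le _ _ h
  refine ⟨fun i => c i, fun b hb => ?_⟩
  rw [fiberRank_add_smul]
  have : FiniteDimensional p.asIdeal.ResidueField (span p.asIdeal.ResidueField
      (Set.range fun i => (fun j => algebraMap A p.asIdeal.ResidueField (w i j)) +
          algebraMap A p.asIdeal.ResidueField ((b • fun i => (c i : A)) i) •
            fun j => algebraMap A p.asIdeal.ResidueField (u j))) :=
    FiniteDimensional.span_of_finite _ (Set.finite_range _)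
  refine finrank_mono ((hc (algebraMap A _ b) ?_).trans_eq ?_)
  · rwa [Ne, Ideal.algebraMap_residueField_eq_zero]
  · simp

variable [Fintype m]

/-- The bad primes, at which eliminating a vector needs care, are finite in number. -/
theorem finite_setOf_fiberRank_eq [IsNoetherianRing A] {Z : Set (PrimeSpectrum A)} (hZ : IsClosed Z)
    {δ : Z → ℕ} (hδ : StrictAnti δ) {n : ℕ} (v : Fin (n + 1) → m → A)
    (hv : ∀ p : Z, min (n + 1) (δ p + 1) ≤ fiberRank v p) :
    {p : Z | δ p + 1 ≤ n ∧ fiberRank v p = δ p + 1}.Finite := by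
  have hfin : (⋃ r ∈ Finset.range (n + 1),
      {p | Minimal (· ∈ Z ∩ {p | fiberRank v p ≤ r}) p}).Finite :=
    Set.Finite.biUnion (Finset.finite_toSet _) fun r _ =>
      PrimeSpectrum.finite_setOf_minimal (hZ.inter (isClosed_setOf_fiberRank_le v r))
  refine (hfin.preimage (f := Subtype.val) Subtype.val_injective.injOn).subset ?_
  rintro p ⟨hpn, hp⟩
  simp only [Set.mem_preimage, Set.mem_iUnion]
  refine ⟨δ p + 1, by simpa using by omega, ⟨p.2, hp.le⟩, ?_⟩
  rintro q ⟨hqZ, hq⟩ hqp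
  by_contra hne
  have hlt : (⟨q, hqZ⟩ : Z) < p := lt_of_le_not_ge hqp hne
  have h1 := hδ hlt
  have h2 := hv ⟨q, hqZ⟩
  have h3 : fiberRank v q ≤ δ p + 1 := hq
  replace h2 := h2.trans h3
  omega

/-- Given `n + 1` vectors with fibre rank at least `min (n + 1) (δ p + 1)` on `Z`, one of them can be
eliminated, adding multiples of it to the others, so that the same bound holds with `n`. -/
theorem exists_eliminate [IsNoetherianRing A] {Z : Set (PrimeSpectrum A)} (hZ : IsClosed Z)
    {δ : Z → ℕ} (hδ : StrictAnti δ) {n : ℕ} (u : m → A) (w : Fin n → m → A)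
    (hv : ∀ p : Z, min (n + 1) (δ p + 1) ≤ fiberRank (Fin.cons u w : Fin (n + 1) → m → A) p) :
    ∃ a : Fin n → A, ∀ p : Z, min n (δ p + 1) ≤ fiberRank (fun i => w i + a i • u) p := by
  obtain ⟨a, ha⟩ := PrimeSpectrum.exists_forall_of_finset (Subtype.val : Z → PrimeSpectrum A)
    Subtype.val_injective
    (fun p (a : Fin n → A) => δ p + 1 ≤ fiberRank (fun i => w i + a i • u) p)
    (fun p a b h c hc => h.trans_eq <| fiberRank_congr fun i j => by
      have : (w i + a i • u) j - (w i + (a + c • b) i • u) j = c * (-(b i * u j)) := by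
        simp; ring
      rw [this]
      exact Ideal.mul_mem_right _ _ hc)
    (finite_setOf_fiberRank_eq hZ hδ _ hv).toFinset
    (fun p hp a => by
      rw [Set.Finite.mem_toFinset] at hp
      obtain ⟨h1, h2⟩ := hp
      rw [← fiberRank_cons_add_smul u w a] at h2
      obtain ⟨c, hc⟩ := exists_fiberRank_cons_le u (fun i => w i + a i • u) p (h2.trans_le h1)
      refine ⟨c, fun b hb => (h2.symm.trans_le (hc b hb)).trans_eq ?_⟩
      congr! 2 with i
      simp [add_smul, add_assoc])
  refine ⟨a, fun p => ?_⟩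
  have h1 := hv p
  have h2 := fiberRank_cons_le u w a p
  by_cases hp : δ p + 1 ≤ n ∧ fiberRank (Fin.cons u w : Fin (n + 1) → m → A) p = δ p + 1
  · exact (min_le_right _ _).trans (ha p (by simpa using hp))
  · omega

theorem exists_notMem_of_fiberRank [IsNoetherianRing A] {Z : Set (PrimeSpectrum A)} (hZ : IsClosed Z)
    {δ : Z → ℕ} (hδ : StrictAnti δ) (n : ℕ) (v : Fin (n + 1) → m → A)
    (hv : ∀ p : Z, min (n + 1) (δ p + 1) ≤ fiberRank v p) :
    ∃ x ∈ span A (Set.range v), ∀ p ∈ Z, ∃ j, x j ∉ p.asIdeal := by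
  induction n with
  | zero =>
    refine ⟨v 0, subset_span ⟨0, rfl⟩, fun p hp => ?_⟩
    have h1 : 1 ≤ fiberRank v p := (by simp : 1 ≤ min (0 + 1) (δ ⟨p, hp⟩ + 1)).trans (hv ⟨p, hp⟩)
    rw [le_fiberRank_iff] at h1
    obtain ⟨s, t, hst⟩ := h1
    have hs : s 0 = 0 := Subsingleton.elim (α := Fin 1) _ _
    exact ⟨t 0, by simpa [hs] using hst⟩
  | succ n ih =>
    obtain ⟨a, ha⟩ := exists_eliminate hZ hδ (v 0) (Fin.tail v) (by simpa using hv)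
    obtain ⟨x, hx, hx'⟩ := ih _ ha
    refine ⟨x, span_le.2 ?_ hx, hx'⟩
    rintro _ ⟨i, rfl⟩
    exact add_mem (subset_span ⟨i.succ, rfl⟩) (smul_mem _ _ (subset_span ⟨0, rfl⟩))

theorem finrank_le_fiberRank {P : Type*} [AddCommGroup P] [Module A P] {n : ℕ}
    (f : (Fin n → A) →ₗ[A] P) (g : P →ₗ[A] Fin n → A) (hfg : f ∘ₗ g = LinearMap.id)
    (p : PrimeSpectrum A) :
    finrank p.asIdeal.ResidueField (p.asIdeal.Fiber P) ≤
      fiberRank (fun i => g (f (Pi.single i 1))) p := by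
  set κ := p.asIdeal.ResidueField
  have hinj : Function.Injective (g.baseChange κ) := by
    refine Function.LeftInverse.injective (g := f.baseChange κ) fun x => ?_
    rw [← LinearMap.comp_apply, ← LinearMap.baseChange_comp, hfg, LinearMap.baseChange_id]
    rfl
  have hle : LinearMap.range (g.baseChange κ) ≤ LinearMap.range ((g ∘ₗ f).baseChange κ) := by
    have : g.baseChange κ = (g ∘ₗ f).baseChange κ ∘ₗ g.baseChange κ := by
      rw [← LinearMap.baseChange_comp, LinearMap.comp_assoc, hfg, LinearMap.comp_id]
    conv_lhs => rw [this]
    exact LinearMap.range_comp_le_range _ _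
  have h1 := finrank_mono hle
  rw [LinearMap.finrank_range_of_inj hinj] at h1
  refine h1.trans_eq ?_
  let b := Algebra.TensorProduct.basis κ (Pi.basisFun A (Fin n))
  have h2 := Matrix.rank_eq_finrank_range_toLin
    (LinearMap.toMatrix b b ((g ∘ₗ f).baseChange κ)) b b
  rw [Matrix.toLin_toMatrix] at h2
  rw [← h2, LinearMap.toMatrix_baseChange, Matrix.rank_eq_finrank_span_cols, fiberRank]
  congr! 4

end fiber

/-- Serre's splitting theorem. -/
theorem serre_splitting
    (A : Type*) [CommRing A] [IsNoetherianRing A] (d : ℕ)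
    (hdim : ringKrullDim (A ⧸ (⊥ : Ideal A).jacobson) = d)
    (P : Type*) [AddCommGroup P] [Module A P]
    [Module.Finite A P] [Module.Projective A P]
    (hrank : ∀ (𝔭 : Ideal A) [𝔭.IsPrime],
      d < Module.finrank (Localization.AtPrime 𝔭) (LocalizedModule 𝔭.primeCompl P)) :
    ∃ p : P, ∃ ψ : P →ₗ[A] A, ψ p = 1 := by
  classical
  set J := (⊥ : Ideal A).jacobson
  obtain ⟨n, f, g, -, -, hfg⟩ := Module.Finite.exists_comp_eq_id_of_projective A P
  rw [ringKrullDim_quotient] at hdim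
  have hcoht (p : PrimeSpectrum.zeroLocus (J : Set A)) : Order.coheight p ≤ d := by
    exact_mod_cast hdim ▸ Order.coheight_le_krullDim p
  have hfin (p : PrimeSpectrum.zeroLocus (J : Set A)) : Order.coheight p < ⊤ :=
    (hcoht p).trans_lt (ENat.natCast_lt_top d)
  let δ : PrimeSpectrum.zeroLocus (J : Set A) → ℕ := fun p => (Order.coheight p).toNat
  have hδ : StrictAnti δ := fun p q hpq => by
    have := Order.coheight_strictAnti hpq (hfin q)
    rwa [← ENat.natCast_toNat (hfin q).ne, ← ENat.natCast_toNat (hfin p).ne, Nat.cast_lt] at this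
  have hrk (p : PrimeSpectrum.zeroLocus (J : Set A)) :
      δ p + 1 ≤ fiberRank (fun i => g (f (Pi.single i 1))) p.1 := by
    refine le_trans ?_ (finrank_le_fiberRank f g hfg p.1)
    rw [← Module.rankAtStalk_eq]
    have h1 : δ p ≤ d := ENat.toNat_le_of_le_natCast (hcoht p)
    have h2 := hrank p.1.asIdeal
    exact Nat.succ_le_of_lt (h1.trans_lt h2)
  have hne : Nonempty (PrimeSpectrum.zeroLocus (J : Set A)) := by
    by_contra h
    rw [not_nonempty_iff] at h
    simp [Order.krullDim_eq_bot] at hdim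
  obtain ⟨n, rfl⟩ : ∃ k, n = k + 1 := by
    refine Nat.exists_eq_succ_of_ne_zero ?_
    rintro rfl
    have := (le_fiberRank_iff _ _ 1).1 (le_of_add_le_right (hrk hne.some))
    exact this.choose 0 |>.elim0
  obtain ⟨x, hx, hx'⟩ := exists_notMem_of_fiberRank (PrimeSpectrum.isClosed_zeroLocus _) hδ n
    (fun i => g (f (Pi.single i 1))) (fun p => (min_le_right _ _).trans (hrk p))
  have hx1 : g (f x) = x := by
    obtain ⟨p, rfl⟩ : x ∈ LinearMap.range g := by
      refine Submodule.span_le.2 ?_ hx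
      rintro _ ⟨i, rfl⟩
      exact ⟨_, rfl⟩
    exact congrArg g (LinearMap.congr_fun hfg p)
  have htop : Ideal.span (Set.range x) = ⊤ := by
    by_contra h
    obtain ⟨M, hM, hle⟩ := Ideal.exists_le_maximal _ h
    obtain ⟨j, hj⟩ := hx' ⟨M, hM.isPrime⟩ (sInf_le ⟨bot_le, hM⟩ : J ≤ M)
    exact hj (hle (Ideal.subset_span ⟨j, rfl⟩))
  obtain ⟨c, hc⟩ := (Ideal.mem_span_range_iff_exists_fun).1
    (htop ▸ Submodule.mem_top : (1 : A) ∈ Ideal.span (Set.range x))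
  refine ⟨f x, (∑ i, c i • LinearMap.proj i) ∘ₗ g, ?_⟩
  simpa [hx1] using hc
end

section
/- Let A be a commutative Noetherian ring of Krull dimension d and P a finitely generated projective A-module of rank > d. Then P is cancellative: if P ⊕ A^r ≅ Q ⊕ A^r for some finitely generated projective A-module Q and positive integer r, then P ≅ Q. (Bass cancellation.) -/
open scoped TensorProduct

/-- If `s` is a finite antichain of primes, none of which contains `a`, then some element of the
coset `b + (a)` avoids all of them. -/
lemma exists_add_mul_notMem_of_antichain {A : Type*} [CommRing A] (s : Finset (Ideal A))
    (hprime : ∀ q ∈ s, q.IsPrime) (hanti : ∀ q ∈ s, ∀ q' ∈ s, q ≤ q' → q = q')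
    (a b : A) (ha : ∀ q ∈ s, a ∉ q) :
    ∃ y, ∀ q ∈ s, b + a * y ∉ q := by
  classical
  set T := s.filter (b ∈ ·)
  set U := s.filter (b ∉ ·)
  have hJ : ¬ ((U.inf id : Ideal A) : Set A) ⊆ ⋃ q ∈ (T : Set (Ideal A)), (q : Set A) := by
    intro h
    obtain ⟨q, hq, hle⟩ := (Ideal.subset_union_prime (f := fun q : Ideal A => q) ⊤ ⊤
      (fun q hq _ _ => hprime q (Finset.mem_filter.1 hq).1)).1 h
    obtain ⟨hqs, hbq⟩ := Finset.mem_filter.1 hq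
    obtain ⟨q', hq', hle'⟩ := (hprime q hqs).inf_le'.1 hle
    obtain ⟨hqs', hbq'⟩ := Finset.mem_filter.1 hq'
    exact hbq' (hanti q' hqs' q hqs hle' ▸ hbq)
  obtain ⟨y, hyU, hyT⟩ := Set.not_subset.1 hJ
  refine ⟨y, fun q hq hmem => ?_⟩
  by_cases hb : b ∈ q
  · have hy : y ∉ q := fun hy =>
      hyT (Set.mem_biUnion (Finset.mem_coe.2 (Finset.mem_filter.2 ⟨hq, hb⟩)) hy)
    exact ((hprime q hq).mem_or_mem ((q.add_mem_iff_right hb).1 hmem)).elim (ha q hq) hy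
  · have hy : y ∈ q := (Finset.inf_le (f := id) (Finset.mem_filter.2 ⟨hq, hb⟩) : _ ≤ q) hyU
    exact hb ((q.add_mem_iff_left (q.mul_mem_left a hy)).1 hmem)

/-- The elements `b i` can be modified by multiples of `a` so that every prime containing all of
them but not `a` has height at least their number. -/
lemma exists_add_mul_le_height {A : Type*} [CommRing A] [IsNoetherianRing A] (a : A) (n : ℕ)
    (b : Fin n → A) :
    ∃ y : Fin n → A, ∀ q : Ideal A, q.IsPrime → (∀ i, b i + a * y i ∈ q) → a ∉ q →
      (n : ℕ∞) ≤ q.height := by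
  classical
  induction n with
  | zero => exact ⟨0, fun q _ _ _ => by simp⟩
  | succ n ih =>
    obtain ⟨y, hy⟩ := ih (fun i => b i.succ)
    set I : Ideal A := Ideal.span (Set.range fun i => b i.succ + a * y i)
    have hfin := Ideal.finite_minimalPrimes_of_isNoetherianRing A I
    obtain ⟨y₀, hy₀⟩ := exists_add_mul_notMem_of_antichain
      (hfin.toFinset.filter (a ∉ ·)) (fun q hq => by
        simp only [Finset.mem_filter, Set.Finite.mem_toFinset] at hq
        exact hq.1.1.1)
      (fun q hq q' hq' hle => by
        simp only [Finset.mem_filter, Set.Finite.mem_toFinset] at hq hq'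
        exact hle.antisymm (hq'.1.2 hq.1.1 hle)) a (b 0)
      (fun q hq => (Finset.mem_filter.1 hq).2)
    refine ⟨Fin.cons y₀ y, fun q hq hmem ha => ?_⟩
    have hIq : I ≤ q := Ideal.span_le.2 <| by
      rintro _ ⟨i, rfl⟩
      simpa using hmem i.succ
    obtain ⟨p, hp, hpq⟩ := Ideal.exists_minimalPrimes_le hIq
    have hap : a ∉ p := fun h => ha (hpq h)
    have hlt : p < q := lt_of_le_of_ne hpq fun h =>
      hy₀ p (by simp [hp, hap]) (h ▸ by simpa using hmem 0)
    have := hp.1.1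
    have hnp : (n : ℕ∞) ≤ p.height :=
      hy p this (fun i => hp.1.2 (Ideal.subset_span ⟨i, rfl⟩)) hap
    push_cast
    exact (add_le_add_left hnp 1).trans (Ideal.height_add_one_le_of_lt_of_isPrime hlt)

/-- Kronecker's theorem: above the Krull dimension, `a` can be absorbed up to radical. -/
lemma exists_mem_radical_span_add_mul {A : Type*} [CommRing A] [IsNoetherianRing A] {n : ℕ}
    (hn : ringKrullDim A < n) (a : A) (b : Fin n → A) :
    ∃ y : Fin n → A, a ∈ (Ideal.span (Set.range fun i => b i + a * y i)).radical := by
  obtain ⟨y, hy⟩ := exists_add_mul_le_height a n b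
  refine ⟨y, ?_⟩
  rw [Ideal.radical_eq_sInf, Ideal.mem_sInf]
  rintro q ⟨hle, hq⟩
  by_contra ha
  have h := hy q hq (fun i => hle (Ideal.subset_span ⟨i, rfl⟩)) ha
  have h' := (Ideal.height_le_ringKrullDim_of_ne_top hq.ne_top).trans_lt hn
  exact absurd (WithBot.coe_le_coe.2 h) (not_le.2 h')

/-- The ideal of values at `p` of linear functionals. -/
def orderIdeal (A : Type*) {P : Type*} [CommRing A] [AddCommGroup P] [Module A P] (p : P) :
    Ideal A :=
  LinearMap.range (Module.Dual.eval A P p)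

lemma mem_orderIdeal {A P : Type*} [CommRing A] [AddCommGroup P] [Module A P] {p : P} {c : A} :
    c ∈ orderIdeal A p ↔ ∃ f : P →ₗ[A] A, f p = c := Iff.rfl

/-- A translation of `p` by a multiple of `a` enlarges its order ideal, up to radical, by `a` times
a given minor of the evaluation pairing. -/
lemma exists_orderIdeal_add_smul {A P : Type*} [CommRing A] [IsNoetherianRing A]
    [AddCommGroup P] [Module A P] {n : ℕ} (hn : ringKrullDim A < n) (p : P) (a : A)
    (f : Fin n → P →ₗ[A] A) (e : Fin n → P) :
    ∃ x : P, orderIdeal A p ≤ (orderIdeal A (p + a • x)).radical ∧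
      a * (Matrix.of fun i j => f i (e j)).det ∈ (orderIdeal A (p + a • x)).radical := by
  set G := Matrix.of fun i j => f i (e j)
  obtain ⟨y, hy⟩ := exists_mem_radical_span_add_mul hn (a * G.det ^ 2) (fun i => f i p)
  set w := G.cramer y
  have hw (i : Fin n) : f i (∑ j, w j • e j) = G.det * y i := by
    have := congrFun (G.mulVec_cramer y) i
    simp only [Matrix.mulVec, dotProduct, Pi.smul_apply, smul_eq_mul] at this
    simp only [map_sum, map_smul, smul_eq_mul, ← this]
    exact Finset.sum_congr rfl fun j _ => mul_comm _ _
  set z := ∑ j, w j • e j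
  set J := orderIdeal A (p + a • G.det • z)
  have hmem : a * G.det ∈ J.radical := by
    have hspan : Ideal.span (Set.range fun i => f i p + a * G.det ^ 2 * y i) ≤ J := by
      rw [Ideal.span_le]
      rintro _ ⟨i, rfl⟩
      refine mem_orderIdeal.2 ⟨f i, ?_⟩
      simp only [map_add, map_smul, hw, smul_eq_mul]
      ring
    have h : (a * G.det) ^ 2 ∈ J.radical := by
      have := J.radical.mul_mem_left a (Ideal.radical_mono hspan hy)
      convert this using 1
      ring
    exact Ideal.mem_radical_of_pow_mem h
  refine ⟨G.det • z, ?_, hmem⟩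
  intro c hc
  obtain ⟨g, rfl⟩ := mem_orderIdeal.1 hc
  have h1 : g (p + a • G.det • z) ∈ J.radical := Ideal.le_radical (mem_orderIdeal.2 ⟨g, rfl⟩)
  have h2 := J.radical.mul_mem_right (g z) hmem
  convert J.radical.sub_mem h1 h2 using 1
  simp only [map_add, map_smul, smul_eq_mul]
  ring

/-- At every maximal ideal, `P` has a system of `n` functionals and `n` elements with invertible
matrix of values, i.e. `P` has a free direct summand of rank `n` there. -/
def HasLocalFreeSummand (A P : Type*) [CommRing A] [AddCommGroup P] [Module A P] (n : ℕ) : Prop :=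
  ∀ m : Ideal A, m.IsMaximal → ∃ (f : Fin n → P →ₗ[A] A) (e : Fin n → P),
    (Matrix.of fun i j => f i (e j)).det ∉ m

lemma HasLocalFreeSummand.prod {A P : Type*} [CommRing A] [AddCommGroup P] [Module A P] {n : ℕ}
    (h : HasLocalFreeSummand A P n) (M : Type*) [AddCommGroup M] [Module A M] :
    HasLocalFreeSummand A (P × M) n := fun m hm => by
  obtain ⟨f, e, hfe⟩ := h m hm
  exact ⟨fun i => f i ∘ₗ LinearMap.fst A P M, fun j => (e j, 0), hfe⟩

lemma HasLocalFreeSummand.of_le_finrank {A P : Type*} [CommRing A] [AddCommGroup P] [Module A P]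
    [Module.Finite A P] [Module.Projective A P] {n : ℕ}
    (hrank : ∀ (m : Ideal A) [m.IsPrime],
      n ≤ Module.finrank (Localization.AtPrime m) (LocalizedModule m.primeCompl P)) :
    HasLocalFreeSummand A P n := by
  intro m hm
  let _ : Field (A ⧸ m) := Ideal.Quotient.field m
  have hfin : n ≤ Module.finrank (A ⧸ m) ((A ⧸ m) ⊗[A] P) := by
    have h := Module.rankAtStalk_baseChange (R := A) (M := P) (S := A ⧸ m) ⊥
    rw [Module.rankAtStalk_eq_finrank_of_free] at h
    exact (hrank _).trans_eq h.symm
  let B := Module.finBasis (A ⧸ m) ((A ⧸ m) ⊗[A] P)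
  have hsurj := TensorProduct.mk_surjective A P (A ⧸ m) Ideal.Quotient.mk_surjective
  choose e he using fun j : Fin n => hsurj (B (Fin.castLE hfin j))
  choose f hf using fun i : Fin n => Module.projective_lifting_property
    (Algebra.linearMap A (A ⧸ m))
    ((B.coord (Fin.castLE hfin i)).restrictScalars A ∘ₗ TensorProduct.mk A (A ⧸ m) P 1)
    Ideal.Quotient.mk_surjective
  refine ⟨f, e, fun hdet => ?_⟩
  rw [← Ideal.Quotient.eq_zero_iff_mem, RingHom.map_det] at hdet
  have hone : (Ideal.Quotient.mk m).mapMatrix (Matrix.of fun i j => f i (e j)) = 1 := by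
    ext i j
    have h := LinearMap.congr_fun (hf i) (e j)
    simp only [LinearMap.comp_apply, LinearMap.restrictScalars_apply, he] at h
    refine (h : _ = _).trans ?_
    simp [Matrix.one_apply, Finsupp.single_apply, Fin.ext_iff, eq_comm]
  rw [hone, Matrix.det_one] at hdet
  exact one_ne_zero hdet

lemma exists_orderIdeal_add_smul_eq_top {A P : Type*} [CommRing A] [IsNoetherianRing A]
    [AddCommGroup P] [Module A P] {n : ℕ} (hn : ringKrullDim A < n)
    (hP : HasLocalFreeSummand A P n) (p : P) (a : A)
    (h1 : orderIdeal A p ⊔ Ideal.span {a} = ⊤) :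
    ∃ x : P, orderIdeal A (p + a • x) = ⊤ := by
  obtain ⟨_, ⟨x, rfl⟩, hmax⟩ := set_has_maximal_iff_noetherian.2 ‹IsNoetherianRing A›
    (Set.range fun x : P => (orderIdeal A (p + a • x)).radical) (Set.range_nonempty _)
  refine ⟨x, by_contra fun hne => ?_⟩
  obtain ⟨m, hm, hle⟩ := Ideal.exists_le_maximal _ hne
  have hrad : (orderIdeal A (p + a • x)).radical ≤ m := hm.isPrime.radical_le_iff.2 hle
  by_cases ha : a ∈ m
  · refine hm.ne_top (top_le_iff.1 (h1 ▸ sup_le ?_ ((Ideal.span_singleton_le_iff_mem m).2 ha)))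
    intro c hc
    obtain ⟨g, rfl⟩ := mem_orderIdeal.1 hc
    have h : g (p + a • x) ∈ m := hle (mem_orderIdeal.2 ⟨g, rfl⟩)
    rw [map_add, map_smul, smul_eq_mul] at h
    exact (m.add_mem_iff_left (m.mul_mem_right _ ha)).1 h
  · obtain ⟨f, e, hdet⟩ := hP m hm
    obtain ⟨z, hz, hz'⟩ := exists_orderIdeal_add_smul hn (p + a • x) a f e
    rw [add_assoc, ← smul_add] at hz hz'
    have heq := (Ideal.radical_le_radical_iff.2 hz).eq_of_not_lt (hmax _ ⟨x + z, rfl⟩)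
    rw [← heq] at hz'
    exact (hm.isPrime.mem_or_mem (hrad hz')).elim ha hdet

/-- An isomorphism matching the second summands induces one on the first summands. -/
lemma nonempty_linearEquiv_of_apply_eq {A P Q : Type*} [CommRing A] [AddCommGroup P] [Module A P]
    [AddCommGroup Q] [Module A Q] (θ : (Q × A) ≃ₗ[A] (P × A)) (hθ : θ (0, 1) = (0, 1)) :
    Nonempty (P ≃ₗ[A] Q) := by
  have hs (t : A) : θ (0, t) = (0, t) := by
    have : ((0, t) : Q × A) = t • (0, 1) := by simp
    rw [this, map_smul, hθ]
    simp
  have hs' (t : A) : θ.symm (0, t) = (0, t) := by rw [LinearEquiv.symm_apply_eq, hs]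
  refine ⟨LinearEquiv.ofLinearMap
    (LinearMap.fst A Q A ∘ₗ θ.symm.toLinearMap ∘ₗ LinearMap.inl A P A)
    (LinearMap.fst A P A ∘ₗ θ.toLinearMap ∘ₗ LinearMap.inl A Q A) ?_ ?_⟩
  · ext q
    have h : (((θ (q, 0)).1, 0) : P × A) = θ (q, 0) - (0, (θ (q, 0)).2) := by
      ext <;> simp
    simp [h, hs']
  · ext p
    have h : (((θ.symm (p, 0)).1, 0) : Q × A) = θ.symm (p, 0) - (0, (θ.symm (p, 0)).2) := by
      ext <;> simp
    simp [h, hs]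

/-- If `p` has order ideal `⊤` after adding a multiple of `a`, then `(p, a)` can be moved to
`(0, 1)` by elementary automorphisms. -/
lemma exists_linearEquiv_apply_eq {A P : Type*} [CommRing A] [AddCommGroup P] [Module A P]
    {p x : P} {a : A} (h : orderIdeal A (p + a • x) = ⊤) :
    ∃ ψ : (P × A) ≃ₗ[A] (P × A), ψ (p, a) = (0, 1) := by
  obtain ⟨f, hf⟩ := mem_orderIdeal.1 ((Ideal.eq_top_iff_one _).1 h)
  let lower (g : P →ₗ[A] A) : (P × A) ≃ₗ[A] (P × A) :=
    LinearEquiv.skewProd (LinearEquiv.refl A P) (LinearEquiv.refl A A) g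
  let upper (u : P) : (P × A) ≃ₗ[A] (P × A) :=
    LinearEquiv.prodComm A P A ≪≫ₗ LinearEquiv.skewProd (LinearEquiv.refl A A)
      (LinearEquiv.refl A P) (LinearMap.toSpanSingleton A P u) ≪≫ₗ LinearEquiv.prodComm A A P
  refine ⟨upper x ≪≫ₗ lower ((1 - a) • f) ≪≫ₗ upper (-(p + a • x)), ?_⟩
  have h₁ : upper x (p, a) = (p + a • x, a) := by simp [upper]
  have h₂ : lower ((1 - a) • f) (p + a • x, a) = (p + a • x, 1) := by
    simp only [lower, LinearEquiv.skewProd_apply, LinearMap.smul_apply, hf]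
    simp
  have h₃ : upper (-(p + a • x)) (p + a • x, 1) = (0, 1) := by simp [upper]
  exact (congrArg (fun v => upper _ (lower _ v)) h₁).trans ((congrArg (upper _) h₂).trans h₃)

lemma HasLocalFreeSummand.nonempty_linearEquiv_of_prod {A P Q : Type*} [CommRing A]
    [IsNoetherianRing A] [AddCommGroup P] [Module A P] [AddCommGroup Q] [Module A Q] {n : ℕ}
    (hn : ringKrullDim A < n) (hP : HasLocalFreeSummand A P n)
    (φ : (P × A) ≃ₗ[A] (Q × A)) : Nonempty (P ≃ₗ[A] Q) := by
  obtain ⟨⟨p, a⟩, hpa⟩ := φ.surjective (0, 1)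
  have h1 : orderIdeal A p ⊔ Ideal.span {a} = ⊤ := by
    rw [Ideal.eq_top_iff_one]
    have hsum : ((p, a) : P × A) = (p, 0) + a • (0, 1) := by simp
    have h := congrArg Prod.snd hpa
    rw [hsum, map_add, map_smul, Prod.snd_add, Prod.smul_snd] at h
    rw [show (1 : A) = ((0, 1) : Q × A).2 from rfl, ← h]
    exact Submodule.add_mem_sup
      (mem_orderIdeal.2 ⟨LinearMap.snd A Q A ∘ₗ φ.toLinearMap ∘ₗ LinearMap.inl A P A, rfl⟩)
      (Ideal.mul_mem_right _ _ (Ideal.mem_span_singleton_self a))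
  obtain ⟨x, hx⟩ := exists_orderIdeal_add_smul_eq_top hn hP p a h1
  obtain ⟨ψ, hψ⟩ := exists_linearEquiv_apply_eq hx
  refine nonempty_linearEquiv_of_apply_eq (φ.symm ≪≫ₗ ψ) ?_
  rw [LinearEquiv.trans_apply, ← hpa, LinearEquiv.symm_apply_apply, hψ]

/-- Splitting the first coordinate off a free summand. -/
def prodPiSuccEquiv (A M : Type*) [CommRing A] [AddCommGroup M] [Module A M] (r : ℕ) :
    ((M × (Fin r → A)) × A) ≃ₗ[A] (M × (Fin (r + 1) → A)) :=
  LinearEquiv.prodAssoc A M (Fin r → A) A ≪≫ₗ (LinearEquiv.refl A M).prodCongr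
    (LinearEquiv.prodComm A (Fin r → A) A ≪≫ₗ Fin.consLinearEquiv A fun _ => A)

lemma HasLocalFreeSummand.nonempty_linearEquiv_of_prod_pi {A P Q : Type*} [CommRing A]
    [IsNoetherianRing A] [AddCommGroup P] [Module A P] [AddCommGroup Q] [Module A Q] {n : ℕ}
    (hn : ringKrullDim A < n) (hP : HasLocalFreeSummand A P n) (r : ℕ)
    (φ : (P × (Fin r → A)) ≃ₗ[A] (Q × (Fin r → A))) : Nonempty (P ≃ₗ[A] Q) := by
  induction r with
  | zero => exact ⟨(LinearEquiv.prodUnique (R := A)).symm ≪≫ₗ φ ≪≫ₗ LinearEquiv.prodUnique⟩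
  | succ r ih =>
    obtain ⟨ψ⟩ := (hP.prod (Fin r → A)).nonempty_linearEquiv_of_prod hn
      (prodPiSuccEquiv A P r ≪≫ₗ φ ≪≫ₗ (prodPiSuccEquiv A Q r).symm)
    exact ih ψ


/-- Bass cancellation theorem. -/
theorem bass_cancellation
    (A : Type*) [CommRing A] [IsNoetherianRing A] (d : ℕ)
    (hdim : ringKrullDim A = d)
    (P : Type*) [AddCommGroup P] [Module A P]
    [Module.Finite A P] [Module.Projective A P]
    (hrank : ∀ (𝔭 : Ideal A) [𝔭.IsPrime],
      d < Module.finrank (Localization.AtPrime 𝔭) (LocalizedModule 𝔭.primeCompl P))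
    (Q : Type*) [AddCommGroup Q] [Module A Q]
    [Module.Finite A Q] [Module.Projective A Q]
    (r : ℕ) (hr : 0 < r)
    (hiso : Nonempty ((P × (Fin r → A)) ≃ₗ[A] (Q × (Fin r → A)))) :
    Nonempty (P ≃ₗ[A] Q) := by
  obtain ⟨φ⟩ := hiso
  have hn : ringKrullDim A < (d + 1 : ℕ) := by
    rw [hdim]
    exact_mod_cast d.lt_succ_self
  exact (HasLocalFreeSummand.of_le_finrank fun m _ => hrank m).nonempty_linearEquiv_of_prod_pi
    hn r φ
end

section
/- Let R be a commutative Noetherian ring and g, f₁, …, f_r ∈ R an R-regular sequence. Then the subring A = R[f₁/g, …, f_r/g] of R_g is isomorphic to R[X₁,…,X_r]/(gX₁ − f₁, …, gX_r − f_r), and consequently A/gA ≅ (R/(g, f₁, …, f_r))[X₁, …, X_r]. -/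
open RingTheory.Sequence Ideal

/-- The ideal generated by the first `i` members of a finite family. -/
abbrev spanInitial {S : Type*} [CommRing S] {r : ℕ} (h : Fin r → S) (i : ℕ) : Ideal S :=
  span (h '' {j | (j : ℕ) < i})

section InitialIdeals

variable {S : Type*} [CommRing S] {r : ℕ}

lemma spanInitial_zero (h : Fin r → S) : spanInitial h 0 = ⊥ := by
  simp [spanInitial]

lemma spanInitial_self (h : Fin r → S) : spanInitial h r = span (Set.range h) := by
  simp [spanInitial]

lemma spanInitial_succ (h : Fin r → S) (i : Fin r) :
    spanInitial h (i + 1) = span {h i} ⊔ spanInitial h i := by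
  have : {j : Fin r | (j : ℕ) < i + 1} = insert i {j : Fin r | (j : ℕ) < i} := by
    ext j
    simp only [Set.mem_ofPred_eq, Set.mem_insert_iff, Fin.ext_iff]
    omega
  rw [spanInitial, this, Set.image_insert_eq, span_insert]

lemma ofList_take_ofFn (h : Fin r → S) (i : ℕ) :
    ofList ((List.ofFn h).take i) = spanInitial h i := by
  refine congrArg span (Set.ext fun x => ?_)
  simp only [Set.mem_ofPred_eq, List.mem_take_iff_getElem, List.getElem_ofFn, Set.mem_image,
    List.length_ofFn, lt_min_iff]
  constructor
  · rintro ⟨j, hj, rfl⟩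
    exact ⟨⟨j, hj.2⟩, hj.1, rfl⟩
  · rintro ⟨j, hj, rfl⟩
    exact ⟨j, ⟨hj, j.2⟩, rfl⟩

lemma span_sup_spanInitial_congr {g : S} {f h : Fin r → S}
    (hfh : ∀ j, f j + h j ∈ span {g}) (i : ℕ) :
    span {g} ⊔ spanInitial f i = span {g} ⊔ spanInitial h i := by
  have key : ∀ {u v : Fin r → S}, (∀ j, u j + v j ∈ span {g}) →
      span {g} ⊔ spanInitial u i ≤ span {g} ⊔ spanInitial v i := by
    intro u v huv
    refine sup_le le_sup_left (span_le.mpr ?_)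
    rintro _ ⟨j, hj, rfl⟩
    rw [SetLike.mem_coe, ← add_sub_cancel_right (u j) (v j)]
    exact sub_mem (mem_sup_left (huv j))
      (mem_sup_right (subset_span (Set.mem_image_of_mem v hj)))
  exact le_antisymm (key hfh) (key fun j => add_comm (f j) (h j) ▸ hfh j)

/-- The first member of a weakly regular sequence is a non-zero-divisor modulo the others. -/
lemma mem_spanInitial_of_mul_mem {g : S} {h : Fin r → S} (hg : ∀ x, g * x = 0 → x = 0)
    (hh : ∀ (i : Fin r) x, h i * x ∈ span {g} ⊔ spanInitial h i →
      x ∈ span {g} ⊔ spanInitial h i) :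
    ∀ i ≤ r, ∀ x, g * x ∈ spanInitial h i → x ∈ spanInitial h i := by
  intro i
  induction i with
  | zero => simpa [spanInitial_zero] using hg
  | succ i ih =>
    intro hi x hx
    have hs := spanInitial_succ h ⟨i, hi⟩
    rw [hs] at hx ⊢
    obtain ⟨c, j, hj, hcj⟩ := mem_span_singleton_sup.mp hx
    have hc := hh ⟨i, hi⟩ c <| mem_span_singleton_sup.mpr ⟨x, -j, neg_mem hj, by
      linear_combination -hcj⟩
    obtain ⟨b, j', hj', rfl⟩ := mem_span_singleton_sup.mp hc
    refine mem_span_singleton_sup.mpr ⟨b, x - h ⟨i, hi⟩ * b, ?_, by ring⟩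
    refine ih (Nat.le_of_succ_le hi) _ ?_
    have : g * (x - h ⟨i, hi⟩ * b) = j + h ⟨i, hi⟩ * j' := by linear_combination -hcj
    rw [this]
    exact add_mem hj (mul_mem_left _ _ hj')

lemma mem_of_mul_mem_of_isSMulRegular_quotient {I : Ideal S} {a : S}
    (h : IsSMulRegular (S ⧸ (I • ⊤ : Submodule S S)) a) {x : S} (hx : a * x ∈ I) : x ∈ I := by
  have := mem_of_isSMulRegular_quotient_of_smul_mem h (x := x) (by simpa using hx)
  simpa using this

lemma RingTheory.Sequence.IsWeaklyRegular.mem_of_mul_mem_cons_ofFn {g : S} {f : Fin r → S}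
    (hreg : IsWeaklyRegular S (g :: List.ofFn f)) (i : Fin r) {x : S}
    (hx : f i * x ∈ span {g} ⊔ spanInitial f i) : x ∈ span {g} ⊔ spanInitial f i := by
  have h := mem_of_mul_mem_of_isSMulRegular_quotient (x := x)
    (hreg.regular_mod_prev (i + 1) (by simp))
  simp only [List.take_succ_cons, List.getElem_cons_succ, List.getElem_ofFn, ofList_cons,
    ofList_take_ofFn] at h
  exact h hx

end InitialIdeals

namespace MvPolynomial

variable {R : Type*} [CommRing R] {r : ℕ}

/-- The ideal of relations `g Xᵢ = fᵢ`. -/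
noncomputable abbrev fractionRelations {σ : Type*} (g : R) (f : σ → R) : Ideal (MvPolynomial σ R) :=
  span (Set.range fun i => C g * X i - C (f i))

lemma mem_fractionRelations_of_C_mul_mem {g : R} {f : Fin r → R}
    (hreg : IsWeaklyRegular R (g :: List.ofFn f)) {p : MvPolynomial (Fin r) R}
    (hp : C g * p ∈ fractionRelations g f) : p ∈ fractionRelations g f := by
  have hregC : IsWeaklyRegular (MvPolynomial (Fin r) R)
      (C g :: List.ofFn fun i => (C (f i) : MvPolynomial (Fin r) R)) := by
    have := hreg.of_flat (S := MvPolynomial (Fin r) R)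
    simpa [List.map_ofFn, Function.comp_def, algebraMap_eq] using this
  have hcongr (j : Fin r) : C (f j) + (C g * X j - C (f j)) ∈
      span {(C g : MvPolynomial (Fin r) R)} :=
    mem_span_singleton.mpr ⟨X j, by ring⟩
  have hg (x : MvPolynomial (Fin r) R) (hx : C g * x = 0) : x = 0 := by
    have := ((isWeaklyRegular_cons_iff _ _ _).mp hregC).1
    exact this (by simpa using hx)
  have key := mem_spanInitial_of_mul_mem (h := fun i => C g * X i - C (f i)) hg
    (fun i x hx => by
      rw [← span_sup_spanInitial_congr hcongr] at hx ⊢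
      refine hregC.mem_of_mul_mem_cons_ofFn i ?_
      have : C (f i) * x = C g * (X i * x) - (C g * X i - C (f i)) * x := by ring
      rw [this]
      exact sub_mem (mem_sup_left (mul_mem_right _ _ (mem_span_singleton_self _))) hx)
    r le_rfl p
  rw [spanInitial_self] at key
  exact key hp

/-- Clearing denominators: modulo `g Xᵢ = fᵢ`, a power of `g` times any polynomial is constant. -/
lemma exists_C_pow_mul_sub_C_mem_fractionRelations {σ : Type*} (g : R) (f : σ → R)
    (p : MvPolynomial σ R) :
    ∃ (n : ℕ) (a : R), C g ^ n * p - C a ∈ fractionRelations g f := by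
  induction p using MvPolynomial.induction_on with
  | C a => exact ⟨0, a, by simp⟩
  | add p q hp hq =>
    obtain ⟨n, a, hp⟩ := hp
    obtain ⟨m, b, hq⟩ := hq
    refine ⟨n + m, g ^ m * a + g ^ n * b, ?_⟩
    convert add_mem (mul_mem_left _ (C g ^ m) hp) (mul_mem_left _ (C g ^ n) hq) using 1
    simp only [map_add, map_mul, map_pow]
    ring
  | mul_X p i hp =>
    obtain ⟨n, a, hp⟩ := hp
    refine ⟨n + 1, a * f i, ?_⟩
    have hi : C g * X i - C (f i) ∈ fractionRelations g f := subset_span ⟨i, rfl⟩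
    convert add_mem (mul_mem_left _ (C g * X i) hp) (mul_mem_left _ (C a) hi) using 1
    simp only [map_mul]
    ring

lemma ker_aeval_mk'_eq_fractionRelations {g : R} {f : Fin r → R}
    (hreg : IsWeaklyRegular R (g :: List.ofFn f))
    (L : Type*) [CommRing L] [Algebra R L] [IsLocalization.Away g L] :
    RingHom.ker (aeval (R := R) fun i : Fin r => IsLocalization.mk' L (f i)
      (⟨g, Submonoid.mem_powers g⟩ : Submonoid.powers g)) = fractionRelations g f := by
  set φ := aeval (R := R) fun i : Fin r => IsLocalization.mk' L (f i)
      (⟨g, Submonoid.mem_powers g⟩ : Submonoid.powers g) with hφ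
  have hle : fractionRelations g f ≤ RingHom.ker φ := by
    refine span_le.mpr ?_
    rintro _ ⟨i, rfl⟩
    simp [hφ]
  refine le_antisymm (fun p hp => ?_) hle
  obtain ⟨n, a, ha⟩ := exists_C_pow_mul_sub_C_mem_fractionRelations g f p
  have hgreg : IsSMulRegular R g := ((isWeaklyRegular_cons_iff _ _ _).mp hreg).1
  have ha0 : a = 0 := by
    have h1 : algebraMap R L a = 0 := by
      have := hle ha
      rw [RingHom.mem_ker] at hp this
      simpa [hp] using this
    obtain ⟨⟨_, m, rfl⟩, hm⟩ := (IsLocalization.map_eq_zero_iff (Submonoid.powers g) L a).mp h1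
    exact (hgreg.pow m) (by simpa using hm)
  rw [ha0, map_zero, sub_zero] at ha
  clear ha0
  induction n with
  | zero => simpa using ha
  | succ n ih =>
    refine ih (mem_fractionRelations_of_C_mul_mem hreg ?_)
    rwa [← mul_assoc, ← pow_succ']

lemma fractionRelations_sup_span_C {σ : Type*} (g : R) (f : σ → R) :
    fractionRelations g f ⊔ span {C g} =
      (span (insert g (Set.range f))).map (C : R →+* MvPolynomial σ R) := by
  have hg : C g ∈ fractionRelations g f ⊔ span {C g} :=
    mem_sup_right (mem_span_singleton_self _)
  rw [map_span]
  apply le_antisymm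
  · have hg' : (C g : MvPolynomial σ R) ∈ span (C '' insert g (Set.range f)) :=
      subset_span ⟨g, Set.mem_insert _ _, rfl⟩
    refine sup_le (span_le.mpr ?_) (span_le.mpr (Set.singleton_subset_iff.mpr hg'))
    rintro _ ⟨i, rfl⟩
    exact sub_mem (mul_mem_right _ _ hg')
      (subset_span ⟨f i, Set.mem_insert_of_mem _ ⟨i, rfl⟩, rfl⟩)
  · refine span_le.mpr ?_
    rintro _ ⟨_, rfl | ⟨i, rfl⟩, rfl⟩
    · exact hg
    · rw [SetLike.mem_coe, ← sub_sub_cancel (C g * X i) (C (f i))]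
      exact sub_mem (mul_mem_right _ _ hg) (mem_sup_left (subset_span ⟨i, rfl⟩))

end MvPolynomial

theorem blowup_ring_presentation
    (R : Type*) [CommRing R] [IsNoetherianRing R]
    (r : ℕ) (g : R) (f : Fin r → R)
    (hreg : RingTheory.Sequence.IsRegular R (g :: List.ofFn f)) :
    Nonempty ((MvPolynomial (Fin r) R ⧸
        Ideal.span (Set.range fun i : Fin r =>
          MvPolynomial.C g * MvPolynomial.X i - MvPolynomial.C (f i)))
      ≃ₐ[R] (Algebra.adjoin R (Set.range fun i : Fin r =>
          IsLocalization.mk' (Localization.Away g) (f i)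
            (⟨g, Submonoid.mem_powers g⟩ : Submonoid.powers g)))) ∧
    Nonempty (((Algebra.adjoin R (Set.range fun i : Fin r =>
          IsLocalization.mk' (Localization.Away g) (f i)
            (⟨g, Submonoid.mem_powers g⟩ : Submonoid.powers g))) ⧸
        Ideal.span {algebraMap R (Algebra.adjoin R (Set.range fun i : Fin r =>
          IsLocalization.mk' (Localization.Away g) (f i)
            (⟨g, Submonoid.mem_powers g⟩ : Submonoid.powers g))) g})
      ≃ₐ[R] MvPolynomial (Fin r) (R ⧸ Ideal.span (insert g (Set.range f)))) := by
  have e : (MvPolynomial (Fin r) R ⧸ MvPolynomial.fractionRelations g f) ≃ₐ[R]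
      Algebra.adjoin R (Set.range fun i : Fin r =>
        IsLocalization.mk' (Localization.Away g) (f i)
          (⟨g, Submonoid.mem_powers g⟩ : Submonoid.powers g)) :=
    (quotientEquivAlgOfEq R (MvPolynomial.ker_aeval_mk'_eq_fractionRelations
      hreg.toIsWeaklyRegular (Localization.Away g)).symm).trans <|
    (quotientKerEquivRange _).trans <|
    Subalgebra.equivOfEq _ _ (Algebra.adjoin_range_eq_range_aeval R _).symm
  refine ⟨⟨e⟩, ⟨?_⟩⟩
  refine (quotientEquivAlg
    ((span {MvPolynomial.C g}).map (Quotient.mkₐ R (MvPolynomial.fractionRelations g f)))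
    _ e ?_).symm.trans <|
    (DoubleQuot.quotQuotEquivQuotSupₐ R _ _).trans <|
    (quotientEquivAlgOfEq R (MvPolynomial.fractionRelations_sup_span_C g f)).trans
      (MvPolynomial.quotientEquivQuotientMvPolynomial _).symm
  rw [map_span, map_span, Set.image_singleton, Set.image_singleton]
  exact congrArg (fun x => span {x}) (e.commutes g).symm
end
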